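/- arXiv:2103.06263 — 2 statements merged into one kernel-verified Lean document; each statement's English description precedes it below -/
import Mathlib

section
/- In the smooth c-transform setup, assume additionally that each F_i is Lipschitz continuous with Lipschitz constant L > 0. Then ψ̄ is L-smooth, i.e., ψ̄ is differentiable and ‖∇ψ̄(φ) − ∇ψ̄(φ')‖ ≤ L ‖φ − φ'‖ for all φ, φ' ∈ ℝ^N. -/
open MeasureTheory Set Filter

noncomputable section

/-- The quantile function of an `L`-Lipschitz cumulative distribution function increases
at rate at least `1 / L`. -/
lemma quantile_sub_ge {F : ℝ → ℝ} (hc : Continuous F) (hm : Monotone F)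
    (hbot : Tendsto F atBot (nhds 0)) (htop : Tendsto F atTop (nhds 1))
    {L : ℝ} (hL : 0 < L) (hlip : ∀ s s' : ℝ, |F s - F s'| ≤ L * |s - s'|)
    {s t : ℝ} (hs : 0 < s) (hst : s ≤ t) (ht : t < 1) :
    (t - s) / L ≤ sInf {x : ℝ | t ≤ F x} - sInf {x : ℝ | s ≤ F x} := by
  have hne : {x : ℝ | t ≤ F x}.Nonempty := (htop.eventually_const_le ht).exists
  have hbdd : ∀ r, 0 < r → BddBelow {x : ℝ | r ≤ F x} := by
    intro r hr
    obtain ⟨b, hb⟩ := (hbot.eventually_lt_const hr).exists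
    exact ⟨b, fun x hx => le_of_lt (hm.reflect_lt (hb.trans_le hx))⟩
  have hmem : t ≤ F (sInf {x : ℝ | t ≤ F x}) :=
    (isClosed_le continuous_const hc).csInf_mem hne (hbdd t (hs.trans_le hst))
  have hle : sInf {x : ℝ | s ≤ F x} ≤ sInf {x : ℝ | t ≤ F x} :=
    csInf_le_csInf (hbdd s hs) hne fun x hx => hst.trans hx
  refine le_of_forall_pos_le_add fun ε hε => ?_
  have hlt : F (sInf {x : ℝ | s ≤ F x} - ε) < s := by
    by_contra! h
    linarith [csInf_le (hbdd s hs) h]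
  have h := (le_abs_self _).trans
    (hlip (sInf {x : ℝ | t ≤ F x}) (sInf {x : ℝ | s ≤ F x} - ε))
  rw [abs_of_nonneg (by linarith)] at h
  rw [div_le_iff₀ hL]
  linarith

/-- A function increasing at rate at least `1 / L` on `(0, 1)` has primitives lying above
their tangent parabolas of curvature `1 / L`. -/
lemma integral_ge_tangent_parabola {q : ℝ → ℝ} {L : ℝ}
    (hq : ∀ s t, 0 < s → s ≤ t → t < 1 → (t - s) / L ≤ q t - q s)
    (hint : ∀ a ∈ Icc (0 : ℝ) 1, ∀ b ∈ Icc (0 : ℝ) 1, IntervalIntegrable q volume a b)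
    {x y : ℝ} (hx : x ∈ Icc (0 : ℝ) 1) (hy : y ∈ Ioo (0 : ℝ) 1) :
    (x - y) * q y + (x - y) ^ 2 / (2 * L) ≤ ∫ t in y..x, q t := by
  have hcalc : ∫ t in y..x, (q y + (t - y) / L) = (x - y) * q y + (x - y) ^ 2 / (2 * L) := by
    rw [intervalIntegral.integral_add (by simp) (Continuous.intervalIntegrable (by fun_prop) _ _),
      intervalIntegral.integral_div, intervalIntegral.integral_comp_sub_right (fun t => t)]
    simp
    ring
  have hii : ∀ a b, IntervalIntegrable (fun t => q y + (t - y) / L) volume a b := fun a b =>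
    Continuous.intervalIntegrable (by fun_prop) _ _
  have hy' : y ∈ Icc (0 : ℝ) 1 := ⟨hy.1.le, hy.2.le⟩
  rw [← hcalc]
  rcases le_total y x with h | h
  · refine intervalIntegral.integral_mono_on_of_le_Ioo h (hii _ _) (hint _ hy' _ hx) fun t ht => ?_
    linarith [hq y t hy.1 ht.1.le (ht.2.trans_le hx.2)]
  · rw [intervalIntegral.integral_symm x y, intervalIntegral.integral_symm x y, neg_le_neg_iff]
    refine intervalIntegral.integral_mono_on_of_le_Ioo h (hint _ hx _ hy') (hii _ _) fun t ht => ?_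
    have := hq t y (hx.1.trans_lt ht.1) ht.2.le hy.2
    have e : (t - y) / L = -((y - t) / L) := by ring
    linarith

/-- The tail integral `p ↦ ∫ t in (1 - p)..1, q t` of a function increasing at rate at least
`1 / L` is strongly concave with modulus `1 / L`. -/
lemma tail_integral_strong_concave {q : ℝ → ℝ} {L : ℝ}
    (hq : ∀ s t, 0 < s → s ≤ t → t < 1 → (t - s) / L ≤ q t - q s)
    (hint : ∀ a ∈ Icc (0 : ℝ) 1, ∀ b ∈ Icc (0 : ℝ) 1, IntervalIntegrable q volume a b)
    {a b r : ℝ} (ha : a ∈ Icc (0 : ℝ) 1) (hb : b ∈ Icc (0 : ℝ) 1) (hr : r ∈ Ioo (0 : ℝ) 1) :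
    (1 - r) * (∫ t in (1 - a)..1, q t) + r * (∫ t in (1 - b)..1, q t)
        + r * (1 - r) * (a - b) ^ 2 / (2 * L)
      ≤ ∫ t in (1 - ((1 - r) * a + r * b))..1, q t := by
  obtain ⟨hr0, hr1⟩ := hr
  have hr1' : 0 < 1 - r := by linarith
  by_cases hab : a = b
  · subst hab
    have : (1 - r) * a + r * a = a := by ring
    rw [this]
    apply le_of_eq
    ring
  set m := (1 - r) * a + r * b with hm
  have hmem : 1 - m ∈ Ioo (0 : ℝ) 1 := by
    obtain ⟨ha0, ha1⟩ := ha
    obtain ⟨hb0, hb1⟩ := hb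
    rcases lt_or_gt_of_ne hab with h | h
    · constructor <;> nlinarith [mul_pos hr0 (sub_pos.2 h), mul_pos hr1' (sub_pos.2 h)]
    · constructor <;> nlinarith [mul_pos hr0 (sub_pos.2 h), mul_pos hr1' (sub_pos.2 h)]
  have ha' : 1 - a ∈ Icc (0 : ℝ) 1 := ⟨by linarith [ha.2], by linarith [ha.1]⟩
  have hb' : 1 - b ∈ Icc (0 : ℝ) 1 := ⟨by linarith [hb.2], by linarith [hb.1]⟩
  have hm' : 1 - m ∈ Icc (0 : ℝ) 1 := ⟨hmem.1.le, hmem.2.le⟩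
  have h1 : (1 : ℝ) ∈ Icc (0 : ℝ) 1 := by simp
  have ea := intervalIntegral.integral_add_adjacent_intervals
    (hint _ hm' _ ha') (hint _ ha' _ h1)
  have eb := intervalIntegral.integral_add_adjacent_intervals
    (hint _ hm' _ hb') (hint _ hb' _ h1)
  have ia := mul_le_mul_of_nonneg_left (integral_ge_tangent_parabola hq hint ha' hmem) hr1'.le
  have ib := mul_le_mul_of_nonneg_left (integral_ge_tangent_parabola hq hint hb' hmem) hr0.le
  have key : (1 - r) * ((1 - a - (1 - m)) * q (1 - m) + (1 - a - (1 - m)) ^ 2 / (2 * L))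
      + r * ((1 - b - (1 - m)) * q (1 - m) + (1 - b - (1 - m)) ^ 2 / (2 * L))
      = r * (1 - r) * (a - b) ^ 2 / (2 * L) := by
    rw [hm]; ring
  have e : (∫ t in (1 - m)..1, q t) = (1 - r) * (∫ t in (1 - m)..1, q t)
      + r * ∫ t in (1 - m)..1, q t := by ring
  rw [e]
  nth_rewrite 1 [← ea]
  rw [← eb]
  linarith

/-- If every affine perturbation `p ↦ ⟪φ, p⟫ + h p` has a maximizer over `s` with quadratic decay
of rate `1 / (2 * L)`, then its maximal value is differentiable in `φ`, with `L`-Lipschitz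
gradient. -/
lemma smooth_of_quadratic_decay {E : Type*} [NormedAddCommGroup E] [InnerProductSpace ℝ E]
    [CompleteSpace E] {L : ℝ} (hL : 0 < L) {s : Set E} {obj : E → E → ℝ} {ψ : E → ℝ}
    (hlin : ∀ φ φ' p, obj φ' p - obj φ p = inner ℝ (φ' - φ) p)
    {P : E → E} (hPs : ∀ φ, P φ ∈ s) (hψ : ∀ φ, ψ φ = obj φ (P φ))
    (hdecay : ∀ φ, ∀ p ∈ s, obj φ p + ‖p - P φ‖ ^ 2 / (2 * L) ≤ obj φ (P φ)) :
    Differentiable ℝ ψ ∧ ∀ φ φ', ‖gradient ψ φ - gradient ψ φ'‖ ≤ L * ‖φ - φ'‖ := by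
  have hlip : ∀ φ φ', ‖P φ - P φ'‖ ≤ L * ‖φ - φ'‖ := by
    intro φ φ'
    have h1 := hdecay φ _ (hPs φ')
    have h2 := hdecay φ' _ (hPs φ)
    have h3 := hlin φ' φ (P φ)
    have h4 := hlin φ' φ (P φ')
    have h5 : inner ℝ (φ - φ') (P φ - P φ') ≤ ‖φ - φ'‖ * ‖P φ - P φ'‖ := real_inner_le_norm _ _
    rw [inner_sub_right] at h5
    rw [norm_sub_rev] at h1
    have h6 : ‖P φ - P φ'‖ ^ 2 / L ≤ ‖φ - φ'‖ * ‖P φ - P φ'‖ := by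
      have e : ‖P φ - P φ'‖ ^ 2 / L = ‖P φ - P φ'‖ ^ 2 / (2 * L) + ‖P φ - P φ'‖ ^ 2 / (2 * L) := by
        field_simp; ring
      linarith
    rw [div_le_iff₀ hL] at h6
    rcases (norm_nonneg (P φ - P φ')).eq_or_lt with h | h
    · rw [← h]; positivity
    · nlinarith
  have hle : ∀ φ, ∀ p ∈ s, obj φ p ≤ obj φ (P φ) := fun φ p hp =>
    (le_add_of_nonneg_right (by positivity)).trans (hdecay φ p hp)
  have hgrad : ∀ φ, HasGradientAt ψ (P φ) φ := by
    intro φ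
    rw [hasGradientAt_iff_isLittleO]
    have hbound : ∀ φ', ‖ψ φ' - ψ φ - inner ℝ (P φ) (φ' - φ)‖ ≤ L * ‖‖φ' - φ‖ ^ 2‖ := by
      intro φ'
      have h1 := hle φ' _ (hPs φ)
      have h2 := hle φ _ (hPs φ')
      have h3 := hlin φ φ' (P φ)
      have h4 := hlin φ φ' (P φ')
      have h5 : inner ℝ (φ' - φ) (P φ' - P φ) ≤ ‖φ' - φ‖ * ‖P φ' - P φ‖ := real_inner_le_norm _ _
      have h6 := mul_le_mul_of_nonneg_left (hlip φ' φ) (norm_nonneg (φ' - φ))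
      rw [inner_sub_right] at h5
      rw [real_inner_comm, hψ, hψ, Real.norm_eq_abs, Real.norm_eq_abs, abs_of_nonneg (by linarith),
        abs_of_nonneg (by positivity)]
      nlinarith
    refine (Asymptotics.IsBigO.of_bound L (Eventually.of_forall hbound)).trans_isLittleO ?_
    have h0 : Tendsto (fun φ' => φ' - φ) (nhds φ) (nhds 0) := by
      have : Tendsto (fun φ' => φ' - φ) (nhds φ) (nhds (φ - φ)) :=
        (continuous_id.sub continuous_const).tendsto φ
      simpa using this
    exact (Asymptotics.isLittleO_norm_pow_id (one_lt_two)).comp_tendsto h0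
  refine ⟨fun φ => (hgrad φ).differentiableAt, fun φ φ' => ?_⟩
  rw [(hgrad φ).gradient, (hgrad φ').gradient]
  exact hlip φ φ'

/-- Smooth `c`-transform for marginal ambiguity sets with `L`-Lipschitz marginal
distribution functions: `ψ̄` is `L`-smooth. -/
theorem stmt_16
    (N : ℕ) (hN : 2 ≤ N)
    (c : Fin N → ℝ)
    (F : Fin N → ℝ → ℝ)
    (hF_cont : ∀ i, Continuous (F i)) (hF_mono : ∀ i, Monotone (F i))
    (hF_range : ∀ i s, F i s ∈ Icc (0 : ℝ) 1)
    (hF_bot : ∀ i, Tendsto (F i) atBot (nhds 0))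
    (hF_top : ∀ i, Tendsto (F i) atTop (nhds 1))
    (Finv : Fin N → ℝ → ℝ)
    (hFinv : ∀ i t, Finv i t = sInf {s : ℝ | t ≤ F i s})
    (hmoment : ∀ i, IntegrableOn (Finv i) (Ioo 0 1) volume)
    (L : ℝ) (hL : 0 < L)
    (hF_lip : ∀ i (s s' : ℝ), |F i s - F i s'| ≤ L * |s - s'|)
    (Δ : Set (EuclideanSpace ℝ (Fin N)))
    (hΔ : Δ = {p : EuclideanSpace ℝ (Fin N) | (∀ i, 0 ≤ p i) ∧ ∑ i, p i = 1})
    (obj : EuclideanSpace ℝ (Fin N) → EuclideanSpace ℝ (Fin N) → ℝ)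
    (hobj : ∀ φ p, obj φ p =
      ∑ i, (φ i - c i) * p i + ∑ i, ∫ t in (1 - p i)..1, Finv i t)
    (ψ : EuclideanSpace ℝ (Fin N) → ℝ)
    (hψ : ∀ φ, ψ φ = sSup (obj φ '' Δ)) :
    Differentiable ℝ ψ ∧
    ∀ φ φ' : EuclideanSpace ℝ (Fin N),
      ‖gradient ψ φ - gradient ψ φ'‖ ≤ L * ‖φ - φ'‖ := by
  have hq : ∀ i s t, 0 < s → s ≤ t → t < 1 → (t - s) / L ≤ Finv i t - Finv i s := by
    intro i s t hs hst ht
    rw [hFinv, hFinv]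
    exact quantile_sub_ge (hF_cont i) (hF_mono i) (hF_bot i) (hF_top i) hL (hF_lip i) hs hst ht
  have hIcc : ∀ i, IntegrableOn (Finv i) (Icc 0 1) volume := fun i =>
    (integrableOn_Icc_iff_integrableOn_Ioo).2 (hmoment i)
  have hint : ∀ i, ∀ a ∈ Icc (0 : ℝ) 1, ∀ b ∈ Icc (0 : ℝ) 1,
      IntervalIntegrable (Finv i) volume a b := fun i a ha b hb =>
    ((hIcc i).mono_set (uIcc_subset_Icc ha hb)).intervalIntegrable
  have hmem : ∀ p ∈ Δ, ∀ i, p i ∈ Icc (0 : ℝ) 1 := by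
    rintro p hp i
    rw [hΔ] at hp
    exact ⟨hp.1 i, hp.2 ▸ Finset.single_le_sum (fun j _ => hp.1 j) (Finset.mem_univ i)⟩
  have hcompact : IsCompact Δ := by
    refine Metric.isCompact_of_isClosed_isBounded ?_ ?_
    · rw [hΔ, ofPred_and, ofPred_forall]
      exact (isClosed_iInter fun i => isClosed_le (by fun_prop) (by fun_prop)).inter
        (isClosed_eq (by fun_prop) (by fun_prop))
    · refine isBounded_iff_forall_norm_le.2 ⟨√N, fun p hp => ?_⟩
      rw [EuclideanSpace.norm_eq]
      apply Real.sqrt_le_sqrt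
      calc ∑ i, ‖p i‖ ^ 2 ≤ ∑ _i : Fin N, (1 : ℝ) := by
            refine Finset.sum_le_sum fun i _ => ?_
            obtain ⟨h0, h1⟩ := hmem p hp i
            rw [Real.norm_eq_abs, sq_abs]
            nlinarith
        _ = N := by simp
  have hnonempty : Δ.Nonempty := by
    refine ⟨EuclideanSpace.single ⟨0, by omega⟩ 1, ?_⟩
    rw [hΔ]
    refine ⟨fun i => ?_, ?_⟩
    · rw [PiLp.single_apply]; split_ifs <;> simp
    · simp
  have hcont : ∀ φ, ContinuousOn (obj φ) Δ := by
    intro φ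
    rw [funext (hobj φ)]
    refine ContinuousOn.add (by fun_prop) (continuousOn_finsetSum _ fun i _ => ?_)
    have h := intervalIntegral.continuousOn_primitive_interval_left
      (a := (0 : ℝ)) (b := 1) (f := Finv i) (μ := volume) (by simpa using hIcc i)
    refine h.comp (f := fun p : EuclideanSpace ℝ (Fin N) => 1 - p i) (by fun_prop) fun p hp => ?_
    have := hmem p hp i
    rw [uIcc_of_le zero_le_one]
    exact ⟨by linarith [this.2], by linarith [this.1]⟩
  have hmax : ∀ φ, ∃ p ∈ Δ, IsMaxOn (obj φ) Δ p := fun φ =>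
    hcompact.exists_isMaxOn hnonempty (hcont φ)
  choose P hPΔ hPmax using hmax
  refine smooth_of_quadratic_decay hL (s := Δ) (obj := obj) (P := P) ?_ hPΔ ?_ ?_
  · intro φ φ' p
    simp only [hobj, PiLp.inner_apply, RCLike.inner_apply, conj_trivial, PiLp.sub_apply]
    rw [add_sub_add_right_eq_sub, ← Finset.sum_sub_distrib]
    exact Finset.sum_congr rfl fun i _ => by ring
  · intro φ
    rw [hψ]
    refine IsGreatest.csSup_eq ⟨mem_image_of_mem _ (hPΔ φ), ?_⟩
    rintro _ ⟨p, hp, rfl⟩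
    exact hPmax φ hp
  · intro φ p hp
    have hr : ∀ r ∈ Ioo (0 : ℝ) 1,
        obj φ p + (1 - r) * (‖p - P φ‖ ^ 2 / (2 * L)) ≤ obj φ (P φ) := by
      intro r hr
      have hseg : (1 - r) • P φ + r • p ∈ Δ := by
        have h1 := hPΔ φ
        rw [hΔ] at h1 hp ⊢
        refine ⟨fun i => ?_, ?_⟩
        · have := mul_nonneg (sub_nonneg.2 hr.2.le) (h1.1 i)
          have := mul_nonneg hr.1.le (hp.1 i)
          simp only [PiLp.add_apply, PiLp.smul_apply, smul_eq_mul]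
          linarith
        · simp only [PiLp.add_apply, PiLp.smul_apply, smul_eq_mul, Finset.sum_add_distrib,
            ← Finset.mul_sum, h1.2, hp.2]
          ring
      have hle : obj φ ((1 - r) • P φ + r • p) ≤ obj φ (P φ) := hPmax φ hseg
      have hsc : (1 - r) * obj φ (P φ) + r * obj φ p + r * (1 - r) * (‖p - P φ‖ ^ 2 / (2 * L))
          ≤ obj φ ((1 - r) • P φ + r • p) := by
        simp only [hobj, EuclideanSpace.norm_sq_eq, Real.norm_eq_abs, sq_abs, mul_add,
          Finset.mul_sum, Finset.sum_div, ← Finset.sum_add_distrib]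
        refine Finset.sum_le_sum fun i _ => ?_
        have h := tail_integral_strong_concave (hq i) (hint i) (hmem _ (hPΔ φ) i) (hmem p hp i) hr
        simp only [PiLp.add_apply, PiLp.smul_apply, PiLp.sub_apply, smul_eq_mul]
        have e : (P φ i - p i) ^ 2 = (p i - P φ i) ^ 2 := by ring
        rw [e] at h
        linear_combination h
      have h : 0 ≤ r * (obj φ (P φ) - (obj φ p + (1 - r) * (‖p - P φ‖ ^ 2 / (2 * L)))) := by
        linarith
      linarith [nonneg_of_mul_nonneg_right h hr.1]
    have hlim : Tendsto (fun r : ℝ => obj φ p + (1 - r) * (‖p - P φ‖ ^ 2 / (2 * L)))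
        (nhdsWithin 0 (Ioi 0)) (nhds (obj φ p + ‖p - P φ‖ ^ 2 / (2 * L))) := by
      have : Continuous fun r : ℝ => obj φ p + (1 - r) * (‖p - P φ‖ ^ 2 / (2 * L)) := by fun_prop
      simpa using (this.tendsto 0).mono_left nhdsWithin_le_nhds
    refine le_of_tendsto hlim ?_
    filter_upwards [Ioo_mem_nhdsGT (zero_lt_one (α := ℝ))] with r using hr r
end
end

section
/- Fix N ≥ 2, real numbers β₁,…,β_N, and continuous cumulative distribution functions F₁,…,F_N : ℝ → [0,1] whose associated probability measures on ℝ have finite first moments, and let F_i^{-1}(t) = inf{s ∈ ℝ : F_i(s) ≥ t} be the quantile function of F_i. Set τ̄ = max_{i} ( β_i − F_i^{-1}(1 − 1/N) ) and τ̲ = min_{i} ( β_i − F_i^{-1}(1 − 1/N) ). Then the function g(τ) = Σ_{i=1}^N ( 1 − F_i(β_i − τ) ) is continuous and nondecreasing on ℝ and satisfies g(τ̲) ≤ 1 ≤ g(τ̄); consequently there exists τ* ∈ [τ̲, τ̄] with g(τ*) = 1, and for any such τ* the vector p* defined by p*_i = 1 − F_i(β_i − τ*) lies in Δ^N and is the unique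 maximizer of max_{p ∈ Δ^N} Σ_{i=1}^N (−β_i) p_i + Σ_{i=1}^N ∫_{1−p_i}^1 F_i^{-1}(t) dt. -/
open MeasureTheory Set Filter

noncomputable section

theorem quantile_le_iff {F : ℝ → ℝ} (hc : Continuous F) (hm : Monotone F)
    (h0 : Tendsto F atBot (nhds 0)) (h1 : Tendsto F atTop (nhds 1))
    {t : ℝ} (ht : t ∈ Ioo (0 : ℝ) 1) (s : ℝ) :
    sInf {s : ℝ | t ≤ F s} ≤ s ↔ t ≤ F s := by
  have hne : {s : ℝ | t ≤ F s}.Nonempty := by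
    obtain ⟨x, hx⟩ := (h1.eventually (lt_mem_nhds ht.2)).exists
    exact ⟨x, hx.le⟩
  have hbdd : BddBelow {s : ℝ | t ≤ F s} := by
    obtain ⟨x, hx⟩ := (h0.eventually (gt_mem_nhds ht.1)).exists
    refine ⟨x, fun y hy => ?_⟩
    by_contra! hyx
    exact absurd (hm hyx.le) (not_le.2 (lt_of_lt_of_le hx hy))
  have hcl : IsClosed {s : ℝ | t ≤ F s} := isClosed_le continuous_const hc
  refine ⟨fun h => ?_, fun h => csInf_le hbdd h⟩
  have hmem : t ≤ F (sInf {s : ℝ | t ≤ F s}) := hcl.csInf_mem hne hbdd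
  exact hmem.trans (hm h)

theorem apply_quantile {F : ℝ → ℝ} (hc : Continuous F) (hm : Monotone F)
    (h0 : Tendsto F atBot (nhds 0)) (h1 : Tendsto F atTop (nhds 1))
    {t : ℝ} (ht : t ∈ Ioo (0 : ℝ) 1) : F (sInf {s : ℝ | t ≤ F s}) = t := by
  refine le_antisymm ?_ ((quantile_le_iff hc hm h0 h1 ht _).1 le_rfl)
  refine le_of_tendsto (hc.continuousWithinAt (s := Iio (sInf {s : ℝ | t ≤ F s}))) ?_
  filter_upwards [self_mem_nhdsWithin] with s hs
  by_contra! h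
  exact absurd ((quantile_le_iff hc hm h0 h1 ht s).2 h.le) (not_le.2 hs)

theorem lt_quantile_of_lt {F : ℝ → ℝ} (hc : Continuous F) (hm : Monotone F)
    (h0 : Tendsto F atBot (nhds 0)) (h1 : Tendsto F atTop (nhds 1))
    {t c : ℝ} (ht : t ∈ Ioo (0 : ℝ) 1) (h : F c < t) : c < sInf {s : ℝ | t ≤ F s} := by
  by_contra! hle
  exact absurd ((quantile_le_iff hc hm h0 h1 ht c).1 hle) (not_le.2 h)

theorem quantile_lt_of_lt {F : ℝ → ℝ} (hc : Continuous F) (hm : Monotone F)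
    (h0 : Tendsto F atBot (nhds 0)) (h1 : Tendsto F atTop (nhds 1))
    {t c : ℝ} (ht : t ∈ Ioo (0 : ℝ) 1) (h : t < F c) : sInf {s : ℝ | t ≤ F s} < c := by
  by_contra! hle
  have := hm hle
  rw [apply_quantile hc hm h0 h1 ht] at this
  exact absurd this (not_le.2 h)

theorem intervalIntegrable_of_integrableOn_Ioo {Q : ℝ → ℝ} (hQ : IntegrableOn Q (Ioo 0 1) volume)
    {a b : ℝ} (ha : a ∈ Icc (0 : ℝ) 1) (hb : b ∈ Icc (0 : ℝ) 1) :
    IntervalIntegrable Q volume a b := by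
  have h : IntegrableOn Q (Icc 0 1) volume := by
    rwa [integrableOn_Icc_iff_integrableOn_Ioo]
  exact (h.mono_set (uIcc_subset_Icc ha hb)).intervalIntegrable

/-- The concave function `p ↦ -b * p + ∫ t in (1 - p)..1, Q t + τ * p`, with `Q` the quantile
function of `F`, is strictly maximized over `[0, 1]` at `p = 1 - F (b - τ)`. -/
theorem quantile_objective_lt {F Q : ℝ → ℝ} (hc : Continuous F) (hm : Monotone F)
    (hr : ∀ s, F s ∈ Icc (0 : ℝ) 1)
    (h0 : Tendsto F atBot (nhds 0)) (h1 : Tendsto F atTop (nhds 1))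
    (hQ : ∀ t, Q t = sInf {s : ℝ | t ≤ F s})
    (hint : IntegrableOn Q (Ioo 0 1) volume) (b τ : ℝ) {p : ℝ} (hp : p ∈ Icc (0 : ℝ) 1)
    (hne : p ≠ 1 - F (b - τ)) :
    -b * p + (∫ t in (1 - p)..1, Q t) + τ * p <
      -b * (1 - F (b - τ)) + (∫ t in (1 - (1 - F (b - τ)))..1, Q t) + τ * (1 - F (b - τ)) := by
  rw [sub_sub_cancel]
  set c := b - τ with hcdef
  have hq := hr c
  have ha : 1 - p ∈ Icc (0 : ℝ) 1 := ⟨by linarith [hp.2], by linarith [hp.1]⟩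
  have hone : (1 : ℝ) ∈ Icc (0 : ℝ) 1 := ⟨zero_le_one, le_rfl⟩
  have hsplit := intervalIntegral.integral_add_adjacent_intervals
    (intervalIntegrable_of_integrableOn_Ioo hint ha hq)
    (intervalIntegrable_of_integrableOn_Ioo hint hq hone)
  have hb : b = c + τ := by rw [hcdef]; ring
  suffices h : ∫ t in (1 - p)..(F c), Q t < c * (F c - (1 - p)) by
    rw [hb, ← hsplit]
    nlinarith
  rcases lt_or_gt_of_ne (show 1 - p ≠ F c from fun h => hne (by linarith)) with hlt | hgt
  · have hi := intervalIntegrable_of_integrableOn_Ioo hint ha hq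
    have hpos := intervalIntegral.intervalIntegral_pos_of_pos_on (f := fun t => c - Q t)
      (intervalIntegrable_const.sub hi) (fun t ht => by
        have := quantile_lt_of_lt hc hm h0 h1
          ⟨ha.1.trans_lt ht.1, ht.2.trans_le hq.2⟩ ht.2
        rw [← hQ] at this
        linarith) hlt
    rw [intervalIntegral.integral_sub intervalIntegrable_const hi,
      intervalIntegral.integral_const, smul_eq_mul] at hpos
    linarith
  · have hi := intervalIntegrable_of_integrableOn_Ioo hint hq ha
    have hpos := intervalIntegral.intervalIntegral_pos_of_pos_on (f := fun t => Q t - c)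
      (hi.sub intervalIntegrable_const) (fun t ht => by
        have := lt_quantile_of_lt hc hm h0 h1
          ⟨hq.1.trans_lt ht.1, ht.2.trans_le ha.2⟩ ht.1
        rw [← hQ] at this
        linarith) hgt
    rw [intervalIntegral.integral_sub hi intervalIntegrable_const,
      intervalIntegral.integral_const, smul_eq_mul] at hpos
    rw [intervalIntegral.integral_symm]
    linarith

/-- Correctness of the bisection characterization: the function
`g(τ) = Σᵢ (1 − Fᵢ(βᵢ − τ))` is continuous and nondecreasing, brackets the value 1 on
`[τlo, τhi]`, hence has a root `τ*` there, and any such root yields the unique maximizer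
`p*ᵢ = 1 − Fᵢ(βᵢ − τ*)` of the smoothed linear program over the simplex. -/
theorem stmt_18
    (N : ℕ) (hN : 2 ≤ N)
    (β : Fin N → ℝ)
    (F : Fin N → ℝ → ℝ)
    (hF_cont : ∀ i, Continuous (F i)) (hF_mono : ∀ i, Monotone (F i))
    (hF_range : ∀ i s, F i s ∈ Icc (0 : ℝ) 1)
    (hF_bot : ∀ i, Tendsto (F i) atBot (nhds 0))
    (hF_top : ∀ i, Tendsto (F i) atTop (nhds 1))
    (Finv : Fin N → ℝ → ℝ)
    (hFinv : ∀ i t, Finv i t = sInf {s : ℝ | t ≤ F i s})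
    (hmoment : ∀ i, IntegrableOn (Finv i) (Ioo 0 1) volume)
    (τhi τlo : ℝ)
    (hτhi : τhi = ⨆ i, (β i - Finv i (1 - 1 / N)))
    (hτlo : τlo = ⨅ i, (β i - Finv i (1 - 1 / N)))
    (g : ℝ → ℝ)
    (hg : ∀ τ, g τ = ∑ i, (1 - F i (β i - τ)))
    (obj : (Fin N → ℝ) → ℝ)
    (hobj : ∀ p, obj p = ∑ i, (-β i) * p i + ∑ i, ∫ t in (1 - p i)..1, Finv i t) :
    Continuous g ∧ Monotone g ∧ g τlo ≤ 1 ∧ 1 ≤ g τhi ∧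
    (∃ τstar ∈ Icc τlo τhi, g τstar = 1) ∧
    (∀ τstar ∈ Icc τlo τhi, g τstar = 1 →
      ((∀ i, 0 ≤ 1 - F i (β i - τstar)) ∧ ∑ i, (1 - F i (β i - τstar)) = 1) ∧
      (∀ p : Fin N → ℝ, (∀ i, 0 ≤ p i) → ∑ i, p i = 1 →
        obj p ≤ obj fun i => 1 - F i (β i - τstar)) ∧
      (∀ p : Fin N → ℝ, (∀ i, 0 ≤ p i) → ∑ i, p i = 1 →
        obj p = obj (fun i => 1 - F i (β i - τstar)) →
        p = fun i => 1 - F i (β i - τstar))) := by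
  have hN0 : (0 : ℝ) < N := by exact_mod_cast (by omega : 0 < N)
  have hN2 : (2 : ℝ) ≤ N := by exact_mod_cast hN
  have hlevel : (1 - 1 / N : ℝ) ∈ Ioo (0 : ℝ) 1 := by
    have h1 : (1 / N : ℝ) < 1 := by rw [div_lt_one hN0]; linarith
    have h2 : (0 : ℝ) < 1 / N := by positivity
    exact ⟨by linarith, by linarith⟩
  have hsumN : ∑ _i : Fin N, (1 / N : ℝ) = 1 := by
    simp [hN0.ne']
  have hFlevel : ∀ i, F i (Finv i (1 - 1 / N)) = 1 - 1 / N := fun i => by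
    rw [hFinv]
    exact apply_quantile (hF_cont i) (hF_mono i) (hF_bot i) (hF_top i) hlevel
  have hlo : ∀ i, τlo ≤ β i - Finv i (1 - 1 / N) := fun i =>
    hτlo ▸ ciInf_le (finite_range _).bddBelow i
  have hhi : ∀ i, β i - Finv i (1 - 1 / N) ≤ τhi := fun i =>
    hτhi ▸ le_ciSup (finite_range fun i => β i - Finv i (1 - 1 / N)).bddAbove i
  have hcont : Continuous g := by
    rw [funext hg]
    exact continuous_finsetSum _ fun i _ =>
      continuous_const.sub ((hF_cont i).comp (continuous_const.sub continuous_id))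
  have hmono : Monotone g := fun a b hab => by
    rw [hg, hg]
    exact Finset.sum_le_sum fun i _ => sub_le_sub_left (hF_mono i (by linarith)) _
  have hglo : g τlo ≤ 1 := by
    rw [hg, ← hsumN]
    refine Finset.sum_le_sum fun i _ => ?_
    have := hF_mono i (show Finv i (1 - 1 / N) ≤ β i - τlo by linarith [hlo i])
    linarith [hFlevel i]
  have hghi : 1 ≤ g τhi := by
    rw [hg, ← hsumN]
    refine Finset.sum_le_sum fun i _ => ?_
    have := hF_mono i (show β i - τhi ≤ Finv i (1 - 1 / N) by linarith [hhi i])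
    linarith [hFlevel i]
  have hle : τlo ≤ τhi := (hlo ⟨0, by omega⟩).trans (hhi _)
  refine ⟨hcont, hmono, hglo, hghi,
    intermediate_value_Icc hle hcont.continuousOn ⟨hglo, hghi⟩, fun τ _ hτ => ?_⟩
  have hsum : ∑ i, (1 - F i (β i - τ)) = 1 := hg τ ▸ hτ
  have hstrict : ∀ p : Fin N → ℝ, (∀ i, 0 ≤ p i) → ∑ i, p i = 1 →
      p ≠ (fun i => 1 - F i (β i - τ)) → obj p < obj fun i => 1 - F i (β i - τ) := by
    intro p hp hps hne
    have hp1 : ∀ i, p i ∈ Icc (0 : ℝ) 1 := fun i =>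
      ⟨hp i, hps ▸ Finset.single_le_sum (fun j _ => hp j) (Finset.mem_univ i)⟩
    have hlt := fun i (hi : p i ≠ 1 - F i (β i - τ)) =>
      quantile_objective_lt (hF_cont i) (hF_mono i) (hF_range i) (hF_bot i) (hF_top i)
        (hFinv i) (hmoment i) (β i) τ (hp1 i) hi
    obtain ⟨j, hj⟩ := Function.ne_iff.1 hne
    have key := Finset.sum_lt_sum (s := Finset.univ)
      (f := fun i => -β i * p i + (∫ t in (1 - p i)..1, Finv i t) + τ * p i)
      (g := fun i => -β i * (1 - F i (β i - τ)) +
        (∫ t in (1 - (1 - F i (β i - τ)))..1, Finv i t) + τ * (1 - F i (β i - τ)))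
      (fun i _ => by
        by_cases hi : p i = 1 - F i (β i - τ)
        · simp only [hi, le_refl]
        · exact (hlt i hi).le)
      ⟨j, Finset.mem_univ j, hlt j hj⟩
    simp only [Finset.sum_add_distrib, ← Finset.mul_sum] at key
    rw [hps, hsum] at key
    rw [hobj, hobj]
    linarith
  refine ⟨⟨fun i => sub_nonneg.2 (hF_range i _).2, hsum⟩, fun p hp hps => ?_,
    fun p hp hps heq => ?_⟩
  · by_cases h : p = fun i => 1 - F i (β i - τ)
    · rw [← h]
    · exact (hstrict p hp hps h).le
  · by_contra h
    exact (hstrict p hp hps h).ne heq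
end
end
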